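/- Let k be a field and R = k[x, y, a, b]/(bx, xy, ax − by, x² − y²), and let U = (a, b) ⊆ R. Then in the minimal graded free resolution of U over R, the first three syzygy modules are generated in degrees 2, 3, and 4 respectively, with Betti numbers β₀(U) = 2, β₁(U) = 3, β₂(U) = 6, β₃(U) = 11; that is, the resolution of U begins R(−4)¹¹ → R(−3)⁶ → R(−2)³ → R(−1)² → U → 0 and is linear through homological degree 3. -/

import Mathlib

open MvPolynomial

noncomputable section
set_option synthInstance.maxHeartbeats 1000000
set_option maxHeartbeats 1000000

variable (k : Type) [Field k]

/-- The defining ideal `(bx, xy, ax − by, x² − y²)` of `R`, where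
`x = X 0`, `y = X 1`, `a = X 2`, `b = X 3` in `k[x,y,a,b]`. -/
def rIdeal : Ideal (MvPolynomial (Fin 4) k) :=
  Ideal.span {X 3 * X 0, X 0 * X 1, X 2 * X 0 - X 3 * X 1, X 0 ^ 2 - X 1 ^ 2}

/-- The ring `R = k[x,y,a,b]/(bx, xy, ax − by, x² − y²)`. -/
abbrev Rring := MvPolynomial (Fin 4) k ⧸ rIdeal k

/-- The set of linear forms (degree-one elements) of `R`. -/
def linR : Set (Rring k) :=
  ↑((homogeneousSubmodule (Fin 4) k 1).map (Ideal.Quotient.mkₐ k (rIdeal k)).toLinearMap)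

/-- The ideal `U = (a, b)` of `R`. -/
def Uideal : Ideal (Rring k) :=
  Ideal.span {Ideal.Quotient.mk (rIdeal k) (X 2), Ideal.Quotient.mk (rIdeal k) (X 3)}

/-- The augmentation `R(−1)² → U ⊆ R`, `(v₀, v₁) ↦ v₀·a + v₁·b`. -/
def piU : Matrix (Fin 1) (Fin 2) (Rring k) :=
  !![Ideal.Quotient.mk (rIdeal k) (X 2), Ideal.Quotient.mk (rIdeal k) (X 3)]

section Generic
variable {k : Type} [Field k] {R : Type} [CommRing R] [Algebra k R]

/-- the map `k[a][b] → R` -/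
def iotaU (a b : R) : Polynomial (Polynomial k) →+* R :=
  Polynomial.eval₂RingHom (Polynomial.eval₂RingHom (algebraMap k R) a) b

/-- normal form -/
def nfU (x y a b : R) (p : Polynomial (Polynomial k)) (q r : Polynomial k) (c : k) : R :=
  iotaU a b p + iotaU a b (Polynomial.C q) * x + iotaU a b (Polynomial.C r) * y
    + algebraMap k R c * x ^ 2

theorem iotaU_X (a b : R) : iotaU (k := k) a b Polynomial.X = b := by simp [iotaU]
theorem iotaU_CX (a b : R) : iotaU (k := k) a b (Polynomial.C Polynomial.X) = a := by simp [iotaU]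
theorem iotaU_CC (a b : R) (c : k) :
    iotaU (k := k) a b (Polynomial.C (Polynomial.C c)) = algebraMap k R c := by simp [iotaU]

theorem iotaU_split (a b : R) (p : Polynomial (Polynomial k)) :
    iotaU a b p = iotaU a b (Polynomial.C (p.coeff 0)) + b * iotaU a b p.divX := by
  conv_lhs => rw [← Polynomial.X_mul_divX_add p]
  rw [map_add, map_mul, iotaU_X, add_comm]

theorem iotaU_splitC (a b : R) (p : Polynomial k) :
    iotaU a b (Polynomial.C p) = algebraMap k R (p.coeff 0) + a * iotaU a b (Polynomial.C p.divX) := by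
  conv_lhs => rw [← Polynomial.X_mul_divX_add p]
  rw [map_add, map_mul, map_add, map_mul, iotaU_CX, iotaU_CC, add_comm]

variable {x y a b : R}

theorem nfU_add (p p' : Polynomial (Polynomial k)) (q q' r r' : Polynomial k) (c c' : k) :
    nfU x y a b p q r c + nfU x y a b p' q' r' c' =
      nfU x y a b (p + p') (q + q') (r + r') (c + c') := by
  simp only [nfU, map_add]; ring

theorem nfU_neg (p : Polynomial (Polynomial k)) (q r : Polynomial k) (c : k) :
    - nfU x y a b p q r c = nfU x y a b (-p) (-q) (-r) (-c) := by
  simp only [nfU, map_neg]; ring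

theorem nfU_zero : nfU x y a b (0 : Polynomial (Polynomial k)) 0 0 0 = 0 := by
  simp [nfU]

structure RelU (x y a b : R) : Prop where
  h1 : b * x = 0
  h2 : x * y = 0
  h3 : a * x = b * y
  h4 : x ^ 2 = y ^ 2

theorem nfU_a (h : RelU x y a b) (p : Polynomial (Polynomial k)) (q r : Polynomial k) (c : k) :
    a * nfU x y a b p q r c =
      nfU x y a b (Polynomial.C Polynomial.X * p) (Polynomial.X * q) (Polynomial.X * r) 0 := by
  obtain ⟨h1, h2, h3, h4⟩ := h
  simp only [nfU, map_mul, iotaU_CX, map_zero]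
  linear_combination (algebraMap k R c * x) * h3 + algebraMap k R c * b * h2

theorem nfU_b (h : RelU x y a b) (p : Polynomial (Polynomial k)) (q r : Polynomial k) (c : k) :
    b * nfU x y a b p q r c =
      nfU x y a b (Polynomial.X * p) (Polynomial.X * r) 0 0 := by
  obtain ⟨h1, h2, h3, h4⟩ := h
  simp only [nfU, map_mul, iotaU_X, iotaU_CX, map_zero]
  linear_combination (iotaU a b (Polynomial.C q) + algebraMap k R c * x) * h1
    - iotaU a b (Polynomial.C r) * h3

theorem nfU_x (h : RelU x y a b) (p : Polynomial (Polynomial k)) (q r : Polynomial k) (c : k) :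
    x * nfU x y a b p q r c =
      nfU x y a b 0 (p.coeff 0) 0 (q.coeff 0) := by
  obtain ⟨h1, h2, h3, h4⟩ := h
  simp only [nfU, map_zero]
  rw [iotaU_split a b p, iotaU_splitC a b q]
  linear_combination (iotaU a b p.divX) * h1 + iotaU a b (Polynomial.C r) * h2
    + iotaU a b (Polynomial.C q.divX) * (x * h3 + b * h2)
    + algebraMap k R c * (x * h4 + y * h2)

theorem nfU_y (h : RelU x y a b) (p : Polynomial (Polynomial k)) (q r : Polynomial k) (c : k) :
    y * nfU x y a b p q r c =
      nfU x y a b 0 (Polynomial.X * p.coeff 1) (p.coeff 0) (r.coeff 0) := by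
  obtain ⟨h1, h2, h3, h4⟩ := h
  have e : p.coeff 1 = p.divX.coeff 0 := by simp [Polynomial.coeff_divX]
  simp only [nfU, map_zero, map_mul, iotaU_CX, e]
  rw [iotaU_split a b p, iotaU_split a b p.divX, iotaU_splitC a b r]
  generalize iotaU a b (Polynomial.C (p.divX.coeff 0)) = D
  generalize iotaU a b p.divX.divX = E
  generalize iotaU a b (Polynomial.C r.divX) = r'
  generalize iotaU a b (Polynomial.C q) = q'
  generalize algebraMap k R (r.coeff 0) = r0
  generalize algebraMap k R c = c
  have f1 : b * b * y = 0 := by linear_combination a * h1 - b * h3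
  have f2 : a * y ^ 2 = 0 := by linear_combination (- a) * h4 + x * h3 + b * h2
  linear_combination (-D) * h3 + E * f1 + q' * h2 + r' * f2 - r0 * h4 + c * x * h2

theorem divX_eqU {S : Type} [CommRing S] (p : Polynomial S) (h : p.coeff 0 = 0) :
    Polynomial.X * p.divX = p := by
  conv_rhs => rw [← Polynomial.X_mul_divX_add p, h]
  simp

theorem kerU_aux (p q : Polynomial (Polynomial k))
    (h : Polynomial.C Polynomial.X * p + Polynomial.X * q = 0) :
    ∃ t, p = Polynomial.X * t ∧ q = - (Polynomial.C Polynomial.X * t) := by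
  have h0 := congrArg (fun f => Polynomial.coeff f 0) h
  simp at h0
  refine ⟨p.divX, (divX_eqU p h0).symm, ?_⟩
  rw [← divX_eqU p h0] at h
  have : (Polynomial.X : Polynomial (Polynomial k)) *
      (q + Polynomial.C Polynomial.X * p.divX) = 0 := by linear_combination h
  have := (mul_eq_zero.mp this).resolve_left Polynomial.X_ne_zero
  linear_combination this

/-- everything we use about `R` -/
structure GoodU (k : Type) [Field k] {R : Type} [CommRing R] [Algebra k R] (x y a b : R) : Prop where
  rel : RelU x y a b
  surj : ∀ s : R, ∃ p q r c, s = nfU (k := k) x y a b p q r c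
  inj : ∀ p q r c, nfU (k := k) x y a b p q r c = 0 → p = 0 ∧ q = 0 ∧ r = 0 ∧ c = 0

theorem exact1 (h : GoodU k x y a b) (v0 v1 : R) (e : a * v0 + b * v1 = 0) :
    ∃ w1 w2 w3, v0 = b * w1 + x * w2 ∧ v1 = - (a * w1) + - (y * w2) + x * w3 := by
  obtain ⟨p0, q0, r0, c0, rfl⟩ := h.surj v0
  obtain ⟨p1, q1, r1, c1, rfl⟩ := h.surj v1
  simp only [nfU_a h.rel, nfU_b h.rel, nfU_add] at e
  obtain ⟨e1, e2, e3, -⟩ := h.inj _ _ _ _ e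
  obtain ⟨t, rfl, rfl⟩ := kerU_aux _ _ e1
  have e2 : r1 = - q0 := by
    have : (Polynomial.X : Polynomial k) * (r1 + q0) = 0 := by linear_combination e2
    have := (mul_eq_zero.mp this).resolve_left Polynomial.X_ne_zero
    linear_combination this
  have e3 : r0 = 0 := by simpa using e3
  subst e2 e3
  refine ⟨nfU x y a b t 0 0 0, nfU x y a b (.C q0) (.C c0) 0 0,
    nfU x y a b (.C q1) (.C c1) 0 0, ?_, ?_⟩
  all_goals
    simp only [nfU_a h.rel, nfU_b h.rel, nfU_x h.rel, nfU_y h.rel, nfU_neg, nfU_add]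
    congr 1 <;> simp [Polynomial.coeff_C]

theorem exact2 (h : GoodU k x y a b) (u v w : R) (e : b * u + x * v = 0)
    (e' : - (a * u) + - (y * v) + x * w = 0) :
    ∃ s1 s2 s3 s4 s5 s6, u = x * s1 + y * s2 ∧ v = - (a * s2) + b * s3 + y * s5 ∧
      w = a * s1 + a * s3 + b * s4 + x * s5 + y * s6 := by
  obtain ⟨pu, qu, ru, cu, rfl⟩ := h.surj u
  obtain ⟨pv, qv, rv, cv, rfl⟩ := h.surj v
  obtain ⟨pw, qw, rw1, cw, rfl⟩ := h.surj w
  simp only [nfU_a h.rel, nfU_b h.rel, nfU_x h.rel, nfU_y h.rel, nfU_neg, nfU_add] at e e'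
  obtain ⟨e1, e2, -, e4⟩ := h.inj _ _ _ _ e
  obtain ⟨-, f2, -, f4⟩ := h.inj _ _ _ _ e'
  have e1 : pu = 0 := by simpa using e1
  subst e1
  have e4 : qv.coeff 0 = 0 := by simpa using e4
  have f4 : (qw - rv).coeff 0 = 0 := by simp; linear_combination f4
  have g : (pw - .C (.X * qu) - .C .X * pv.divX).coeff 0 = 0 := by
    simp [Polynomial.coeff_divX]; linear_combination f2
  have hpv := Polynomial.X_mul_divX_add pv
  have e2 : pv.coeff 0 = - (.X * ru) := by linear_combination e2
  rw [e2] at hpv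
  have gg := divX_eqU _ g
  have ff := divX_eqU _ f4
  have ee := divX_eqU _ e4
  refine ⟨nfU x y a b (.C qu) (.C cu) 0 0, nfU x y a b (.C ru) (-qv.divX) 0 0,
    nfU x y a b pv.divX 0 0 0,
    nfU x y a b (pw - .C (.X * qu) - .C .X * pv.divX).divX 0 ((qw - rv).divX - .C cu) 0,
    nfU x y a b (.C rv) 0 (.C cv) 0, nfU x y a b (.C rw1) 0 (.C cw) 0, ?_, ?_, ?_⟩
  all_goals
    simp only [nfU_a h.rel, nfU_b h.rel, nfU_x h.rel, nfU_y h.rel, nfU_neg, nfU_add]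
    congr 1
  all_goals simp [Polynomial.coeff_C]
  · simp at hpv; linear_combination -hpv
  · linear_combination -ee
  · simp at gg; linear_combination -gg
  · linear_combination -ff

theorem exact3 (h : GoodU k x y a b) (s1 s2 s3 s4 s5 s6 : R) (e : x * s1 + y * s2 = 0)
    (e' : - (a * s2) + b * s3 + y * s5 = 0)
    (e'' : a * s1 + a * s3 + b * s4 + x * s5 + y * s6 = 0) :
    ∃ h1 h2 h3 h4 h5 h6 h7 h8 h9 h10 h11,
      s1 = -(a * h1) + b * h2 + y * h3 + -(x * h5) ∧
      s2 = b * h1 + x * h4 + y * h5 + x * h6 ∧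
      s3 = a * h1 + y * h4 + x * h7 ∧
      s4 = -(a * h2) + -(y * h7) + -(y * h8) + x * h11 ∧
      s5 = a * h5 + b * h6 + x * h9 ∧
      s6 = -(a * h3) + -(a * h4) + b * h8 + -(y * h9) + x * h10 := by
  obtain ⟨p1, q1, r1, c1, rfl⟩ := h.surj s1
  obtain ⟨p2, q2, r2, c2, rfl⟩ := h.surj s2
  obtain ⟨p3, q3, r3, c3, rfl⟩ := h.surj s3
  obtain ⟨p4, q4, r4, c4, rfl⟩ := h.surj s4
  obtain ⟨p5, q5, r5, c5, rfl⟩ := h.surj s5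
  obtain ⟨p6, q6, r6, c6, rfl⟩ := h.surj s6
  simp only [nfU_a h.rel, nfU_b h.rel, nfU_x h.rel, nfU_y h.rel, nfU_neg, nfU_add] at e e' e''
  obtain ⟨-, -, -, A4⟩ := h.inj _ _ _ _ e
  obtain ⟨B1, B2, B3, B4⟩ := h.inj _ _ _ _ e'
  obtain ⟨C1, C2, C3, C4⟩ := h.inj _ _ _ _ e''
  have XX : ∀ f : Polynomial k, Polynomial.X * f = 0 → f = 0 := fun f hf =>
    (mul_eq_zero.mp hf).resolve_left Polynomial.X_ne_zero
  obtain ⟨t, rfl, ht⟩ := kerU_aux p2 (-p3) (by linear_combination - B1)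
  obtain ⟨m, hm, rfl⟩ := kerU_aux (p1 + p3) p4 (by linear_combination C1)
  have hP5 : p5.coeff 0 = .X * r2 := by linear_combination B3
  have hq2 : q2 = r3 + p5.coeff 1 := by
    have := XX (r3 + p5.coeff 1 - q2) (by linear_combination B2)
    linear_combination -this
  have hr4 : r4 = -(q1 + q3 + r2 + p6.coeff 1) := by
    have := XX (q1 + q3 + r4 + r2 + p6.coeff 1) (by linear_combination C2 - hP5)
    linear_combination this
  have hP6 : p6.coeff 0 = - (.X * r1) - .X * r3 := by linear_combination C3
  have h12 := divX_eqU (q1 + r2) (by simpa using A4)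
  have h5 := divX_eqU r5 (by simpa using B4)
  have h56 := divX_eqU (q5 + (r6 + .C c1 * .X)) (by simpa using C4)
  have hp5 := Polynomial.X_mul_divX_add p5
  have hp6 := Polynomial.X_mul_divX_add p6
  rw [hP5] at hp5
  rw [hP6] at hp6
  refine ⟨nfU x y a b t 0 0 0, nfU x y a b m 0 (q1 + r2).divX 0,
    nfU x y a b (.C r1) 0 (.C c1) 0, nfU x y a b (.C r3) 0 0 0,
    nfU x y a b (.C r2) 0 r5.divX 0,
    nfU x y a b p5.divX (.C (c2 - r5.divX.coeff 0)) (q5 + (r6 + .C c1 * .X)).divX 0,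
    nfU x y a b (.C q3) (.C c3) 0 0,
    nfU x y a b p6.divX 0 0 0,
    nfU x y a b (.C (-(r6 + .C c1 * .X))) (.C c5) 0 0,
    nfU x y a b (.C q6) (.C c6) 0 0,
    nfU x y a b (.C (q4 + .X * p6.divX.coeff 1)) (.C c4) 0 0, ?_, ?_, ?_, ?_, ?_, ?_⟩
  all_goals
    simp only [nfU_a h.rel, nfU_b h.rel, nfU_x h.rel, nfU_y h.rel, nfU_neg, nfU_add]
    congr 1
  all_goals simp [Polynomial.coeff_C, Polynomial.coeff_divX]
  · linear_combination hm + ht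
  · linear_combination - h12
  · exact hq2
  · linear_combination - ht
  · linear_combination hr4 + h12
  · simp only [map_mul] at hp5
    linear_combination - hp5
  · linear_combination - h56
  · exact h5.symm
  · simp only [map_mul, map_sub, map_neg] at hp6
    linear_combination - hp6

end Generic

section Inst
variable (k : Type) [Field k]

theorem relU_R : RelU (Ideal.Quotient.mk (rIdeal k) (X 0)) (Ideal.Quotient.mk (rIdeal k) (X 1))
    (Ideal.Quotient.mk (rIdeal k) (X 2)) (Ideal.Quotient.mk (rIdeal k) (X 3)) := by
  constructor
  · rw [← map_mul, Ideal.Quotient.eq_zero_iff_mem]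
    exact Ideal.subset_span (by simp)
  · rw [← map_mul, Ideal.Quotient.eq_zero_iff_mem]
    exact Ideal.subset_span (by simp)
  · rw [← map_mul, ← map_mul, Ideal.Quotient.eq]
    exact Ideal.subset_span (by simp)
  · rw [← map_pow, ← map_pow, Ideal.Quotient.eq]
    exact Ideal.subset_span (by simp)

/-- quotient lift -/
def liftU {S : Type} [CommRing S] [Algebra k S] (f : Fin 4 → S)
    (h : RelU (f 0) (f 1) (f 2) (f 3)) : Rring k →+* S :=
  Ideal.Quotient.lift (rIdeal k) (aeval f).toRingHom (by
    intro p hp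
    have : rIdeal k ≤ RingHom.ker (aeval (R := k) f).toRingHom := by
      rw [rIdeal, Ideal.span_le]
      rintro _ (rfl | rfl | rfl | rfl)
      · simpa [RingHom.mem_ker] using h.h1
      · simpa [RingHom.mem_ker] using h.h2
      · simpa [RingHom.mem_ker, sub_eq_zero] using h.h3
      · simpa [RingHom.mem_ker, sub_eq_zero] using h.h4
    exact this hp)

theorem liftU_X {S : Type} [CommRing S] [Algebra k S] (f : Fin 4 → S)
    (h : RelU (f 0) (f 1) (f 2) (f 3)) (i : Fin 4) :
    liftU k f h (Ideal.Quotient.mk (rIdeal k) (X i)) = f i := by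
  simp [liftU]

theorem liftU_alg {S : Type} [CommRing S] [Algebra k S] (f : Fin 4 → S)
    (h : RelU (f 0) (f 1) (f 2) (f 3)) (c : k) :
    liftU k f h (algebraMap k (Rring k) c) = algebraMap k S c := by
  have : algebraMap k (Rring k) c = Ideal.Quotient.mk (rIdeal k) (C c) := rfl
  rw [this]
  simp [liftU]

theorem liftU_iota {S : Type} [CommRing S] [Algebra k S] (f : Fin 4 → S)
    (h : RelU (f 0) (f 1) (f 2) (f 3)) (p : Polynomial (Polynomial k)) :
    liftU k f h (iotaU (Ideal.Quotient.mk (rIdeal k) (X 2)) (Ideal.Quotient.mk (rIdeal k) (X 3)) p)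
      = iotaU (f 2) (f 3) p := by
  rw [← RingHom.comp_apply]
  congr 1
  refine Polynomial.ringHom_ext' (Polynomial.ringHom_ext' ?_ ?_) ?_
  · ext c
    simp only [RingHom.comp_apply, iotaU_CC, liftU_alg]
  · simp only [RingHom.comp_apply, iotaU_CX, liftU_X]
  · simp only [RingHom.comp_apply, iotaU_X, liftU_X]

theorem liftU_nf {S : Type} [CommRing S] [Algebra k S] (f : Fin 4 → S)
    (h : RelU (f 0) (f 1) (f 2) (f 3)) (p : Polynomial (Polynomial k)) (q r : Polynomial k) (c : k) :
    liftU k f h (nfU (Ideal.Quotient.mk (rIdeal k) (X 0)) (Ideal.Quotient.mk (rIdeal k) (X 1))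
      (Ideal.Quotient.mk (rIdeal k) (X 2)) (Ideal.Quotient.mk (rIdeal k) (X 3)) p q r c)
      = nfU (f 0) (f 1) (f 2) (f 3) p q r c := by
  simp only [nfU, map_add, map_mul, map_pow, liftU_iota, liftU_alg, liftU_X]

theorem iotaU_id (p : Polynomial (Polynomial k)) :
    iotaU (k := k) (R := Polynomial (Polynomial k))
      (Polynomial.C Polynomial.X) Polynomial.X p = p := by
  have : (iotaU (k := k) (R := Polynomial (Polynomial k)) (Polynomial.C Polynomial.X) Polynomial.X :
      Polynomial (Polynomial k) →+* Polynomial (Polynomial k)) = RingHom.id _ := by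
    refine Polynomial.ringHom_ext' (Polynomial.ringHom_ext' ?_ ?_) ?_
    · ext c : 1
      simp only [RingHom.comp_apply, iotaU_CC]; rfl
    · simp only [RingHom.comp_apply, iotaU_CX]; rfl
    · simp only [iotaU_X]; rfl
  rw [this]; rfl

theorem inj_p (p : Polynomial (Polynomial k)) (q r : Polynomial k) (c : k)
    (h : nfU (Ideal.Quotient.mk (rIdeal k) (X 0)) (Ideal.Quotient.mk (rIdeal k) (X 1))
      (Ideal.Quotient.mk (rIdeal k) (X 2)) (Ideal.Quotient.mk (rIdeal k) (X 3)) p q r c = 0) :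
    p = 0 := by
  have h' := congrArg (liftU k (S := Polynomial (Polynomial k))
    ![0, 0, Polynomial.C Polynomial.X, Polynomial.X] (by constructor <;> simp)) h
  rw [liftU_nf, map_zero] at h'
  simpa [nfU, iotaU_id k p] using h'

theorem inj_qr (q r : Polynomial k) (c : k)
    (h : nfU (Ideal.Quotient.mk (rIdeal k) (X 0)) (Ideal.Quotient.mk (rIdeal k) (X 1))
      (Ideal.Quotient.mk (rIdeal k) (X 2)) (Ideal.Quotient.mk (rIdeal k) (X 3)) 0 q r c = 0) :
    q = 0 ∧ r = 0 := by
  have key : ∀ s : Polynomial k, iotaU (R := DualNumber (DualNumber (Polynomial k)))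
      (.inl (.inl Polynomial.X)) (.inl (.inr 1)) (Polynomial.C s) = .inl (.inl s) := by
    intro s
    have : (iotaU (R := DualNumber (DualNumber (Polynomial k)))
      (.inl (.inl Polynomial.X)) (.inl (.inr 1))).comp Polynomial.C =
      (TrivSqZeroExt.inlHom _ _).comp (TrivSqZeroExt.inlHom _ _) := by
      refine Polynomial.ringHom_ext' ?_ ?_
      · ext c : 1
        simp only [RingHom.comp_apply, iotaU_CC]; rfl
      · simp only [RingHom.comp_apply, iotaU_CX]; rfl
    exact congrArg (fun f => f s) this
  have h' := congrArg (liftU k (S := DualNumber (DualNumber (Polynomial k)))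
    ![.inr (.inr 1), .inr (.inl Polynomial.X), .inl (.inl Polynomial.X), .inl (.inr 1)]
    (by constructor <;> simp [pow_two, TrivSqZeroExt.ext_iff])) h
  rw [liftU_nf, map_zero] at h'
  have h2 : TrivSqZeroExt.inl (TrivSqZeroExt.inl q) * TrivSqZeroExt.inr (TrivSqZeroExt.inr 1)
      + TrivSqZeroExt.inl (TrivSqZeroExt.inl r) * TrivSqZeroExt.inr (TrivSqZeroExt.inl Polynomial.X)
      = (0 : DualNumber (DualNumber (Polynomial k))) := by
    rw [← key q, ← key r, ← h']
    have sq : (TrivSqZeroExt.inr (TrivSqZeroExt.inr 1) : DualNumber (DualNumber (Polynomial k))) ^ 2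
        = 0 := by
      rw [pow_two, TrivSqZeroExt.inr_mul_inr]
    simp only [nfU, map_zero, Matrix.cons_val, sq, mul_zero, add_zero, zero_add]
  simp [TrivSqZeroExt.ext_iff] at h2
  tauto

theorem inj_c (c : k)
    (h : nfU (Ideal.Quotient.mk (rIdeal k) (X 0)) (Ideal.Quotient.mk (rIdeal k) (X 1))
      (Ideal.Quotient.mk (rIdeal k) (X 2)) (Ideal.Quotient.mk (rIdeal k) (X 3)) 0 0 0 c = 0) :
    c = 0 := by
  have h' : Ideal.Quotient.mk (rIdeal k) (C c * X 0 ^ 2) = 0 := by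
    rw [← h]; simp [nfU]; rfl
  rw [Ideal.Quotient.eq_zero_iff_mem] at h'
  have key : ∀ p ∈ rIdeal k, coeff (Finsupp.single 0 2) p + coeff (Finsupp.single 1 2) p = 0 := by
    intro p hp
    rw [rIdeal] at hp
    simp only [Ideal.mem_span_insert, Ideal.mem_span_singleton'] at hp
    obtain ⟨f1, _, ⟨f2, _, ⟨f3, _, ⟨f4, rfl⟩, rfl⟩, rfl⟩, rfl⟩ := hp
    simp only [mul_sub, pow_two, ← mul_assoc, coeff_add, coeff_sub, coeff_mul_X']
    simp [← Finsupp.single_tsub]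
  have := key _ h'
  have ne : (Finsupp.single (0 : Fin 4) 2) ≠ Finsupp.single 1 2 := by
    intro e
    have := DFunLike.congr_fun e 0
    simp at this
  simpa [coeff_C_mul, coeff_X_pow, ne] using this

theorem goodU_R : GoodU k (Ideal.Quotient.mk (rIdeal k) (X 0)) (Ideal.Quotient.mk (rIdeal k) (X 1))
    (Ideal.Quotient.mk (rIdeal k) (X 2)) (Ideal.Quotient.mk (rIdeal k) (X 3)) := by
  refine ⟨relU_R k, ?_, ?_⟩
  · intro s
    obtain ⟨f, rfl⟩ := Ideal.Quotient.mk_surjective s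
    induction f using MvPolynomial.induction_on with
    | C c =>
      refine ⟨.C (.C c), 0, 0, 0, ?_⟩
      simp [nfU, iotaU_CC]; rfl
    | add f g hf hg =>
      obtain ⟨p, q, r, c, hf⟩ := hf
      obtain ⟨p', q', r', c', hg⟩ := hg
      rw [map_add, hf, hg, nfU_add]
      exact ⟨_, _, _, _, rfl⟩
    | mul_X f i hf =>
      obtain ⟨p, q, r, c, hf⟩ := hf
      rw [map_mul, hf, mul_comm]
      fin_cases i
      · exact ⟨_, _, _, _, nfU_x (relU_R k) p q r c⟩
      · exact ⟨_, _, _, _, nfU_y (relU_R k) p q r c⟩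
      · exact ⟨_, _, _, _, nfU_a (relU_R k) p q r c⟩
      · exact ⟨_, _, _, _, nfU_b (relU_R k) p q r c⟩
  · intro p q r c h
    obtain rfl := inj_p k p q r c h
    obtain ⟨rfl, rfl⟩ := inj_qr k q r c h
    exact ⟨rfl, rfl, rfl, inj_c k c h⟩

theorem linR_X (i : Fin 4) : Ideal.Quotient.mk (rIdeal k) (X i) ∈ linR k :=
  ⟨X i, isHomogeneous_X k i, rfl⟩
theorem linR_negX (i : Fin 4) : - Ideal.Quotient.mk (rIdeal k) (X i) ∈ linR k :=
  Submodule.neg_mem _ (linR_X k i)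
theorem linR_zero : (0 : Rring k) ∈ linR k := Submodule.zero_mem _

end Inst

/-- The minimal graded free resolution of `U = (a,b)` over
`R = k[x,y,a,b]/(bx, xy, ax − by, x² − y²)` begins
`R(−4)¹¹ → R(−3)⁶ → R(−2)³ → R(−1)² → U → 0`, i.e. the Betti numbers of `U` are
`β₀ = 2, β₁ = 3, β₂ = 6, β₃ = 11` and the resolution is linear through homological
degree `3`: there exist matrices of linear forms `d₁, d₂, d₃` of sizes `2×3`, `3×6`, `6×11`
forming, together with the augmentation by `(a, b)`, an exact complex. -/
theorem resolution_of_U_linear_through_three :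
    ∃ (d₁ : Matrix (Fin 2) (Fin 3) (Rring k))
      (d₂ : Matrix (Fin 3) (Fin 6) (Rring k))
      (d₃ : Matrix (Fin 6) (Fin 11) (Rring k)),
      (∀ i j, d₁ i j ∈ linR k) ∧ (∀ i j, d₂ i j ∈ linR k) ∧ (∀ i j, d₃ i j ∈ linR k) ∧
      Submodule.map (LinearMap.proj (0 : Fin 1)) (LinearMap.range (piU k).mulVecLin) =
        Uideal k ∧
      Function.Exact d₁.mulVecLin (piU k).mulVecLin ∧
      Function.Exact d₂.mulVecLin d₁.mulVecLin ∧
      Function.Exact d₃.mulVecLin d₂.mulVecLin := by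
  obtain hg := goodU_R k
  have H0 := linR_zero k
  have Hx := linR_X k 0
  have Hy := linR_X k 1
  have Ha := linR_X k 2
  have Hb := linR_X k 3
  have Hx' := linR_negX k 0
  have Hy' := linR_negX k 1
  have Ha' := linR_negX k 2
  have hpi : piU k = !![Ideal.Quotient.mk (rIdeal k) (X 2), Ideal.Quotient.mk (rIdeal k) (X 3)] := rfl
  have hU : Uideal k = Ideal.span
    {Ideal.Quotient.mk (rIdeal k) (X 2), Ideal.Quotient.mk (rIdeal k) (X 3)} := rfl
  generalize hx : Ideal.Quotient.mk (rIdeal k) (X 0) = x at *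
  generalize hy : Ideal.Quotient.mk (rIdeal k) (X 1) = y at *
  generalize ha : Ideal.Quotient.mk (rIdeal k) (X 2) = a at *
  generalize hb : Ideal.Quotient.mk (rIdeal k) (X 3) = b at *
  rw [hU, hpi]
  generalize linR k = L at *
  clear hx hy ha hb hU hpi
  obtain ⟨r1, r2, r3, r4⟩ := hg.rel
  refine ⟨!![b, x, 0; -a, -y, x],
    !![x, y, 0, 0, 0, 0; 0, -a, b, 0, y, 0; a, 0, a, b, x, y],
    !![-a, b, y, 0, -x, 0, 0, 0, 0, 0, 0;
       b, 0, 0, x, y, x, 0, 0, 0, 0, 0;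
       a, 0, 0, y, 0, 0, x, 0, 0, 0, 0;
       0, -a, 0, 0, 0, 0, -y, -y, 0, 0, x;
       0, 0, 0, 0, a, b, 0, 0, x, 0, 0;
       0, 0, -a, -a, 0, 0, 0, b, -y, x, 0], ?_, ?_, ?_, ?_, ?_, ?_, ?_⟩
  · intro i j
    fin_cases i <;> fin_cases j <;> assumption
  · intro i j
    fin_cases i <;> fin_cases j <;> assumption
  · intro i j
    fin_cases i <;> fin_cases j <;> assumption
  · ext s
    simp only [Submodule.mem_map, LinearMap.mem_range, Ideal.mem_span_pair]
    constructor
    · rintro ⟨_, ⟨v, rfl⟩, rfl⟩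
      refine ⟨v 0, v 1, ?_⟩
      simp [Matrix.mulVec, dotProduct, Fin.sum_univ_succ]
      ring
    · rintro ⟨u, v, rfl⟩
      refine ⟨_, ⟨![u, v], rfl⟩, ?_⟩
      simp [mul_comm]
  · intro v
    constructor
    · intro e
      have e0 := congrFun e 0
      simp [Matrix.mulVec, dotProduct, Fin.sum_univ_succ] at e0
      obtain ⟨w1, w2, w3, h1, h2⟩ := exact1 hg (v 0) (v 1) e0
      refine ⟨![w1, w2, w3], ?_⟩
      ext i
      fin_cases i <;> simp [Matrix.mulVec, dotProduct, Fin.sum_univ_succ]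
      · rw [h1]
      · rw [h2]; ring
    · rintro ⟨w, rfl⟩
      ext i
      fin_cases i; simp [Matrix.mulVec, dotProduct, Fin.sum_univ_succ]
      grind
  · intro v
    constructor
    · intro e
      have e0 := congrFun e 0
      have e1 := congrFun e 1
      simp [Matrix.mulVec, dotProduct, Fin.sum_univ_succ] at e0 e1
      obtain ⟨w1, w2, w3, w4, w5, w6, h1, h2, h3⟩ := exact2 hg (v 0) (v 1) (v 2)
        (by linear_combination e0) (by linear_combination e1)
      refine ⟨![w1, w2, w3, w4, w5, w6], ?_⟩
      ext i
      fin_cases i <;> simp [Matrix.mulVec, dotProduct, Fin.sum_univ_succ]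
      · rw [h1]
      · rw [h2]; ring
      · rw [h3]; ring
    · rintro ⟨w, rfl⟩
      ext i
      fin_cases i <;> simp [Matrix.mulVec, dotProduct, Fin.sum_univ_succ] <;> grind
  · intro v
    constructor
    · intro e
      have e0 := congrFun e 0
      have e1 := congrFun e 1
      have e2 := congrFun e 2
      simp [Matrix.mulVec, dotProduct, Fin.sum_univ_succ] at e0 e1 e2
      obtain ⟨w1, w2, w3, w4, w5, w6, w7, w8, w9, w10, w11, h1, h2, h3, h4, h5, h6⟩ :=
        exact3 hg (v 0) (v 1) (v 2) (v 3) (v 4) (v 5)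
        (by linear_combination e0) (by linear_combination e1) (by linear_combination e2)
      refine ⟨![w1, w2, w3, w4, w5, w6, w7, w8, w9, w10, w11], ?_⟩
      ext i
      fin_cases i <;> simp [Matrix.mulVec, dotProduct, Fin.sum_univ_succ]
      · rw [h1]; ring
      · rw [h2]; ring
      · rw [h3]; ring
      · rw [h4]; ring
      · rw [h5]; ring
      · rw [h6]; ring
    · rintro ⟨w, rfl⟩
      ext i
      fin_cases i <;> simp [Matrix.mulVec, dotProduct, Fin.sum_univ_succ] <;> grind

end
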